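/- arXiv:0909.4577 — 2 statements merged into one kernel-verified Lean document; each statement's English description precedes it below -/
import Mathlib

section
/- Let n ≥ 6 and let G be a bicyclic graph with n vertices and matching number 2 that is not isomorphic to B_n(n−1,3). Then χ(G) ≥ 1/√(n+2) + 2/√n + (n−5)/√(n−1) + 2/√6 + 1/√5, with equality if and only if G is isomorphic to B_n(n−2,4). -/
open SimpleGraph

/-- The degree of a vertex (stated via `Set.ncard`, so no decidability assumptions). -/
noncomputable def degR {V : Type*} (G : SimpleGraph V) (v : V) : ℕ :=
  (G.neighborSet v).ncard

/-- The sum-connectivity index `χ(G) = ∑_{uv ∈ E(G)} 1/√(d_G(u)+d_G(v))`. -/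
noncomputable def sumConn {V : Type*} [Fintype V] (G : SimpleGraph V) : ℝ :=
  ∑ e ∈ G.edgeSet.toFinite.toFinset,
    Sym2.lift ⟨fun u v => (1 : ℝ) / Real.sqrt ((degR G u : ℝ) + (degR G v : ℝ)),
      fun u v => by simp [add_comm]⟩ e

/-- The matching number: the maximum size of a set of pairwise non-adjacent edges. -/
noncomputable def matchingNumber {V : Type*} (G : SimpleGraph V) : ℕ :=
  sSup {k | ∃ M : Set (Sym2 V), M ⊆ G.edgeSet ∧
    M.Pairwise (fun e f => ∀ v, v ∈ e → v ∉ f) ∧ M.ncard = k}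

/-- Vertex type of the graph `B_n(a,b)`. -/
def BabVert (a b : ℕ) : Type := Fin 4 ⊕ Fin (a - 3) ⊕ Fin (b - 3)

instance (a b : ℕ) : Fintype (BabVert a b) := by unfold BabVert; infer_instance

def BabRel (a b : ℕ) : BabVert a b → BabVert a b → Prop
  | Sum.inl i, Sum.inl j =>
      (i = 0 ∧ j = 1) ∨ (i = 0 ∧ j = 2) ∨ (i = 0 ∧ j = 3) ∨ (i = 1 ∧ j = 2) ∨ (i = 1 ∧ j = 3)
  | Sum.inl i, Sum.inr (Sum.inl _) => i = 0
  | Sum.inl i, Sum.inr (Sum.inr _) => i = 1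
  | _, _ => False

/-- The graph `B_n(a,b)` (where `a + b = n + 2`): the unique 4-vertex bicyclic graph
(`K₄` minus the edge between vertices `2` and `3`), with `a - 3` pendent vertices
attached to the degree-three vertex `0` and `b - 3` pendent vertices attached to
the degree-three vertex `1`. -/
def BabGraph (a b : ℕ) : SimpleGraph (BabVert a b) := SimpleGraph.fromRel (BabRel a b)

/-- The auxiliary function `s ↦ s / √(s + 4) + c / √(s + 5)`. -/
noncomputable def starWeight (c s : ℝ) : ℝ := s / √(s + 4) + c / √(s + 5)

theorem starWeight_eq_rpow (c : ℝ) {s : ℝ} (hs : -1 < s) :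
    starWeight c s =
      (s + 4) ^ (1 / 2 : ℝ) - 4 * (s + 4) ^ (-1 / 2 : ℝ) + c * (s + 5) ^ (-1 / 2 : ℝ) := by
  have h4 : 0 < s + 4 := by linarith
  have h5 : 0 < s + 5 := by linarith
  have e (x : ℝ) (hx : 0 < x) : x ^ (-1 / 2 : ℝ) = (√x)⁻¹ := by
    rw [Real.sqrt_eq_rpow, ← Real.rpow_neg hx.le]; norm_num
  rw [e _ h4, e _ h5, ← Real.sqrt_eq_rpow, starWeight]
  have := Real.sqrt_pos.2 h4
  have hq := Real.sq_sqrt h4.le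
  have := Real.sqrt_pos.2 h5
  field_simp
  rw [hq]; ring

theorem strictConcaveOn_starWeight {c : ℝ} (hc : c ≤ 4) :
    StrictConcaveOn ℝ (Set.Ioi (-1)) (starWeight c) := by
  have hd (r k : ℝ) {s : ℝ} (hs : 0 < s + k) :
      HasDerivAt (fun t : ℝ => (t + k) ^ r) (r * (s + k) ^ (r - 1)) s := by
    have := ((hasDerivAt_id s).add_const k).rpow_const (p := r) (Or.inl hs.ne')
    simpa using this
  have h1 : ∀ s ∈ Set.Ioi (-1 : ℝ), HasDerivAt (starWeight c)
      (1 / 2 * (s + 4) ^ (-1 / 2 : ℝ) + 2 * (s + 4) ^ (-3 / 2 : ℝ)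
        - c / 2 * (s + 5) ^ (-3 / 2 : ℝ)) s := by
    intro s hs
    have hs' : -1 < s := hs
    have key := ((hd (1 / 2) 4 (s := s) (by linarith)).sub
      ((hd (-1 / 2) 4 (s := s) (by linarith)).const_mul 4)).add
      ((hd (-1 / 2) 5 (s := s) (by linarith)).const_mul c)
    have key' := key.congr_of_eventuallyEq (f₁ := starWeight c) (by
      filter_upwards [isOpen_Ioi.mem_nhds hs] with t ht
      exact starWeight_eq_rpow c ht)
    refine key'.congr_deriv ?_
    norm_num
    ring
  have h2 : ∀ s ∈ Set.Ioi (-1 : ℝ), HasDerivAt (deriv (starWeight c))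
      (-1 / 4 * (s + 4) ^ (-3 / 2 : ℝ) - 3 * (s + 4) ^ (-5 / 2 : ℝ)
        + 3 * c / 4 * (s + 5) ^ (-5 / 2 : ℝ)) s := by
    intro s hs
    have hs' : -1 < s := hs
    have key := (((hd (-1 / 2) 4 (s := s) (by linarith)).const_mul (1 / 2)).add
      ((hd (-3 / 2) 4 (s := s) (by linarith)).const_mul 2)).sub
      ((hd (-3 / 2) 5 (s := s) (by linarith)).const_mul (c / 2))
    have key' := key.congr_of_eventuallyEq (f₁ := deriv (starWeight c)) (by
      filter_upwards [isOpen_Ioi.mem_nhds hs] with t ht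
      exact (h1 t ht).deriv)
    refine key'.congr_deriv ?_
    norm_num
    ring
  refine strictConcaveOn_of_deriv2_neg' (convex_Ioi _)
    (fun s hs => (h1 s hs).continuousAt.continuousWithinAt) fun s hs => ?_
  have hs' : -1 < s := hs
  rw [Function.iterate_succ, Function.iterate_one, Function.comp_apply, (h2 s hs).deriv]
  have a1 : 0 < (s + 4) ^ (-3 / 2 : ℝ) := Real.rpow_pos_of_pos (by linarith) _
  have a2 : 0 < (s + 5) ^ (-5 / 2 : ℝ) := Real.rpow_pos_of_pos (by linarith) _
  have a3 : (s + 5) ^ (-5 / 2 : ℝ) ≤ (s + 4) ^ (-5 / 2 : ℝ) :=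
    Real.rpow_le_rpow_of_nonpos (by linarith) (by linarith) (by norm_num)
  nlinarith

theorem StrictConcaveOn.add_lt_add_of_sum_eq {S : Set ℝ} {f : ℝ → ℝ} (hf : StrictConcaveOn ℝ S f)
    {a b p q : ℝ} (ha : a ∈ S) (hb : b ∈ S) (hp : a < p) (hq : a < q) (h : p + q = a + b) :
    f a + f b < f p + f q := by
  have hab : a < b := by linarith
  have hd : 0 < b - a := by linarith
  have hw : (b - p) / (b - a) + (p - a) / (b - a) = 1 := by field_simp; ring
  have w1 : 0 < (b - p) / (b - a) := div_pos (by linarith) hd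
  have w2 : 0 < (p - a) / (b - a) := div_pos (by linarith) hd
  have k1 := hf.2 ha hb hab.ne w1 w2 hw
  have k2 := hf.2 hb ha hab.ne' w1 w2 hw
  simp only [smul_eq_mul] at k1 k2
  have e1 : (b - p) / (b - a) * a + (p - a) / (b - a) * b = p := by field_simp; ring
  have e2 : (b - p) / (b - a) * b + (p - a) / (b - a) * a = q := by
    rw [show q = a + b - p by linarith]; field_simp; ring
  rw [e1] at k1
  rw [e2] at k2
  linear_combination k1 + k2 - (f a + f b) * hw

theorem inv_sqrt_lt {x y : ℝ} (hx : 0 < x) (h : x < y) : 1 / √y < 1 / √x :=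
  one_div_lt_one_div_of_lt (Real.sqrt_pos.2 hx) (Real.sqrt_lt_sqrt hx.le h)

theorem two_mul_inv_sqrt_le {x : ℝ} (hx : 1 < x) : 2 / √x ≤ 1 / √(x - 1) + 1 / √(x + 1) := by
  have p1 : 0 < √(x - 1) := Real.sqrt_pos.2 (by linarith)
  have p2 : 0 < √(x + 1) := Real.sqrt_pos.2 (by linarith)
  have p0 : 0 < √x := Real.sqrt_pos.2 (by linarith)
  have q1 := Real.sq_sqrt (show 0 ≤ x - 1 by linarith)
  have q2 := Real.sq_sqrt (show 0 ≤ x + 1 by linarith)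
  have q0 := Real.sq_sqrt (show 0 ≤ x by linarith)
  generalize √(x - 1) = a at *
  generalize √(x + 1) = b at *
  generalize √x = m at *
  have hs : a + b ≤ 2 * m := by nlinarith [sq_nonneg (a - b)]
  have h1 : 4 / (a + b) ≤ 1 / a + 1 / b := by
    rw [div_add_div _ _ p1.ne' p2.ne', div_le_div_iff₀ (by positivity) (by positivity)]
    nlinarith [sq_nonneg (a - b)]
  refine le_trans ?_ h1
  rw [div_le_div_iff₀ p0 (by positivity)]
  linarith

theorem three_disjoint_edges_of_matchingNumber {V : Type*} [Fintype V] {G : SimpleGraph V}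
    (h : matchingNumber G = 2) {a b c d e f : V} (hab : G.Adj a b) (hcd : G.Adj c d)
    (hef : G.Adj e f) (hac : a ≠ c) (had : a ≠ d) (hbc : b ≠ c) (hbd : b ≠ d)
    (hae : a ≠ e) (haf : a ≠ f) (hbe : b ≠ e) (hbf : b ≠ f)
    (hce : c ≠ e) (hcf : c ≠ f) (hde : d ≠ e) (hdf : d ≠ f) : False := by
  classical
  have hb : BddAbove {k | ∃ M : Set (Sym2 V), M ⊆ G.edgeSet ∧
      M.Pairwise (fun e f => ∀ v, v ∈ e → v ∉ f) ∧ M.ncard = k} := by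
    refine ⟨Nat.card (Sym2 V), ?_⟩
    rintro k ⟨M, -, -, rfl⟩
    exact Set.ncard_le_card M
  have h3 : 3 ≤ matchingNumber G := by
    refine le_csSup hb ⟨{s(a, b), s(c, d), s(e, f)}, ?_, ?_, ?_⟩
    · intro x hx
      simp only [Set.mem_insert_iff, Set.mem_singleton_iff] at hx
      rcases hx with rfl | rfl | rfl <;> assumption
    · intro x hx y hy hxy v hvx hvy
      simp only [Set.mem_insert_iff, Set.mem_singleton_iff] at hx hy
      rcases hx with rfl | rfl | rfl <;> rcases hy with rfl | rfl | rfl <;>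
        simp only [Sym2.mem_iff] at hvx hvy <;> grind
    · rw [Set.ncard_eq_three]
      refine ⟨_, _, _, ?_, ?_, ?_, rfl⟩ <;> rw [Ne, Sym2.eq_iff] <;> tauto
  omega

theorem exists_disjoint_edges_of_matchingNumber {V : Type*} [Fintype V] {G : SimpleGraph V}
    (h : matchingNumber G = 2) : ∃ a b c d : V, G.Adj a b ∧ G.Adj c d ∧
      a ≠ c ∧ a ≠ d ∧ b ≠ c ∧ b ≠ d := by
  have hb : BddAbove {k | ∃ M : Set (Sym2 V), M ⊆ G.edgeSet ∧
      M.Pairwise (fun e f => ∀ v, v ∈ e → v ∉ f) ∧ M.ncard = k} := by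
    refine ⟨Nat.card (Sym2 V), ?_⟩
    rintro k ⟨M, -, -, rfl⟩
    exact Set.ncard_le_card M
  have hne : {k | ∃ M : Set (Sym2 V), M ⊆ G.edgeSet ∧
      M.Pairwise (fun e f => ∀ v, v ∈ e → v ∉ f) ∧ M.ncard = k}.Nonempty := ⟨0, ∅, by simp⟩
  obtain ⟨M, hM, hP, hc⟩ := Nat.sSup_mem hne hb
  change M.ncard = matchingNumber G at hc
  rw [h, Set.ncard_eq_two] at hc
  obtain ⟨x, y, hxy, rfl⟩ := hc
  have hd := hP (by simp) (by simp) hxy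
  have hx : x ∈ G.edgeSet := hM (by simp)
  have hy : y ∈ G.edgeSet := hM (by simp)
  induction x with | _ a b
  induction y with | _ c d
  refine ⟨a, b, c, d, hx, hy, ?_⟩
  simp only [Sym2.mem_iff] at hd
  grind

/-- Two vertices meet every edge. -/
def CoveredByTwo {V : Type*} (G : SimpleGraph V) : Prop :=
  ∃ u v, u ≠ v ∧ ∀ w z, G.Adj w z → w = u ∨ w = v ∨ z = u ∨ z = v

/-- One vertex meets every edge that is not contained in some triple of other vertices. -/
def CoveredByStarAndTriple {V : Type*} (G : SimpleGraph V) : Prop :=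
  ∃ u x y z, u ≠ x ∧ u ≠ y ∧ u ≠ z ∧ x ≠ y ∧ y ≠ z ∧ x ≠ z ∧
    ∀ s t, G.Adj s t → s = u ∨ t = u ∨
      ((s = x ∨ s = y ∨ s = z) ∧ (t = x ∨ t = y ∨ t = z))

/-- The edges `ab` and `cd` are disjoint and `O` is the set of vertices they miss. -/
structure DisjointEdges {V : Type*} (G : SimpleGraph V) (O : Set V) (a b c d : V) : Prop where
  adj₁ : G.Adj a b
  adj₂ : G.Adj c d
  ac : a ≠ c
  ad : a ≠ d
  bc : b ≠ c
  bd : b ≠ d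
  mem_iff : ∀ z, z ∈ O ↔ z ≠ a ∧ z ≠ b ∧ z ≠ c ∧ z ≠ d

namespace DisjointEdges

variable {V : Type*} {G : SimpleGraph V} {O : Set V} {a b c d : V}

theorem swap (P : DisjointEdges G O a b c d) : DisjointEdges G O c d a b :=
  ⟨P.adj₂, P.adj₁, P.ac.symm, P.bc.symm, P.ad.symm, P.bd.symm, fun z => by rw [P.mem_iff]; tauto⟩

theorem flip (P : DisjointEdges G O a b c d) : DisjointEdges G O b a c d :=
  ⟨P.adj₁.symm, P.adj₂, P.bc, P.bd, P.ac, P.ad, fun z => by rw [P.mem_iff]; tauto⟩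

theorem not_adj [Fintype V] (P : DisjointEdges G O a b c d) (h : matchingNumber G = 2) {w z : V}
    (hw : w ∈ O) (hz : z ∈ O) : ¬ G.Adj w z := by
  intro hwz
  obtain ⟨hab, hcd, hac, had, hbc, hbd, hO⟩ := P
  rw [hO] at hw hz
  apply three_disjoint_edges_of_matchingNumber h hab hcd hwz <;> grind

theorem eq_of_adj [Fintype V] (P : DisjointEdges G O a b c d) (h : matchingNumber G = 2) {w z : V}
    (hw : w ∈ O) (hz : z ∈ O) (haw : G.Adj a w) (hbz : G.Adj b z) : w = z := by
  by_contra hne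
  obtain ⟨hab, hcd, hac, had, hbc, hbd, hO⟩ := P
  rw [hO] at hw hz
  have := hab.ne
  apply three_disjoint_edges_of_matchingNumber h haw hbz hcd <;> grind

theorem not_adj_of_adj [Fintype V] (P : DisjointEdges G O a b c d) (h : matchingNumber G = 2) {w z : V}
    (hw : w ∈ O) (hz : z ∈ O) (hwz : w ≠ z) (haw : G.Adj a w) (hcz : G.Adj c z) :
    ¬ G.Adj b d := by
  intro hbd'
  obtain ⟨hab, hcd, hac, had, hbc, hbd, hO⟩ := P
  rw [hO] at hw hz
  have := hab.ne
  have := hcd.ne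
  apply three_disjoint_edges_of_matchingNumber h haw hcz hbd' <;> grind

theorem coveredByStarAndTriple [Fintype V] (P : DisjointEdges G O a b c d) (h : matchingNumber G = 2)
    (hb : ∀ z ∈ O, ¬ G.Adj b z) (hd : ∀ z ∈ O, ¬ G.Adj d z) (hbd : G.Adj b d) {w z : V}
    (hw : w ∈ O) (hz : z ∈ O) (hwz : w ≠ z) (haw : G.Adj a w) (haz : G.Adj a z) :
    CoveredByStarAndTriple G := by
  refine ⟨a, b, c, d, P.adj₁.ne, P.ac, P.ad, P.bc, P.adj₂.ne, P.bd, fun s t hst => ?_⟩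
  have hc : ∀ y ∈ O, ¬ G.Adj c y := by
    intro y hy hcy
    rcases eq_or_ne w y with rfl | hne
    · exact P.not_adj_of_adj h hz hy hwz.symm haz hcy hbd
    · exact P.not_adj_of_adj h hw hy hne haw hcy hbd
  have hOO : ∀ x ∈ O, ∀ y ∈ O, ¬ G.Adj x y := fun x hx y hy => P.not_adj h hx hy
  have hO := P.mem_iff
  have := hst.symm
  have := hst.ne
  clear hw hz hwz haw haz hbd P h
  grind

theorem covered_of_single [Fintype V] (P : DisjointEdges G O a b c d) (h : matchingNumber G = 2)
    (hnbr : ∀ w, ∃ z, G.Adj w z) (hO2 : ∃ w ∈ O, ∃ z ∈ O, w ≠ z)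
    (hb : ∀ z ∈ O, ¬ G.Adj b z) (hd : ∀ z ∈ O, ¬ G.Adj d z) :
    CoveredByTwo G ∨ CoveredByStarAndTriple G := by
  have hOO : ∀ x ∈ O, ∀ y ∈ O, ¬ G.Adj x y := fun x hx y hy => P.not_adj h hx hy
  have hO := P.mem_iff
  by_cases hbd' : G.Adj b d
  · have hn : ∀ z ∈ O, G.Adj a z ∨ G.Adj c z := by
      intro z hz
      obtain ⟨t, ht⟩ := hnbr z
      have := ht.symm
      clear hnbr P h hbd' hO2
      grind
    obtain ⟨w, hw, z, hz, hwz⟩ := hO2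
    rcases hn w hw with k1 | k1 <;> rcases hn z hz with k2 | k2
    · exact Or.inr (P.coveredByStarAndTriple h hb hd hbd' hw hz hwz k1 k2)
    · exact (P.not_adj_of_adj h hw hz hwz k1 k2 hbd').elim
    · exact (P.not_adj_of_adj h hz hw hwz.symm k2 k1 hbd').elim
    · exact Or.inr (P.swap.coveredByStarAndTriple h hd hb hbd'.symm hw hz hwz k1 k2)
  · refine Or.inl ⟨a, c, P.ac, fun w z hwz => ?_⟩
    have := hwz.symm
    have := hwz.ne
    clear hnbr P h hO2
    grind

theorem covered_of_triangle [Fintype V] (P : DisjointEdges G O a b c d) (h : matchingNumber G = 2)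
    (hnbr : ∀ w, ∃ z, G.Adj w z) (hO2 : ∃ w ∈ O, ∃ z ∈ O, w ≠ z)
    (hx : ∃ x ∈ O, G.Adj a x ∧ G.Adj b x) (hd : ∀ z ∈ O, ¬ G.Adj d z) :
    CoveredByStarAndTriple G := by
  obtain ⟨x, hx, hax, hbx⟩ := hx
  have ha : ∀ w ∈ O, G.Adj a w → w = x := fun w hw haw => P.eq_of_adj h hw hx haw hbx
  have hb : ∀ w ∈ O, G.Adj b w → w = x := fun w hw hbw => P.flip.eq_of_adj h hw hx hbw hax
  have hOO : ∀ x ∈ O, ∀ y ∈ O, ¬ G.Adj x y := fun x hx y hy => P.not_adj h hx hy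
  obtain ⟨y, hy, hxy⟩ : ∃ y ∈ O, x ≠ y := by
    obtain ⟨w, hw, z, hz, hwz⟩ := hO2
    rcases eq_or_ne x w with rfl | hne
    · exact ⟨z, hz, hwz⟩
    · exact ⟨w, hw, hne⟩
  have hO := P.mem_iff
  have hcy : G.Adj c y := by
    obtain ⟨t, ht⟩ := hnbr y
    have := ht.symm
    clear hnbr P h hO2
    grind
  have nad : ¬ G.Adj a d := P.flip.not_adj_of_adj h hx hy hxy hbx hcy
  have nbd : ¬ G.Adj b d := P.not_adj_of_adj h hx hy hxy hax hcy
  have hx' := (hO x).1 hx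
  refine ⟨c, a, b, x, P.ac.symm, P.bc.symm, hx'.2.2.1.symm, P.adj₁.ne, hx'.2.1.symm,
    hx'.1.symm, fun s t hst => ?_⟩
  have := hst.symm
  have := hst.ne
  clear hnbr P h hO2
  grind

theorem triangle_or_single [Fintype V] (P : DisjointEdges G O a b c d) (h : matchingNumber G = 2) :
    (∃ x ∈ O, G.Adj a x ∧ G.Adj b x) ∨ (∀ z ∈ O, ¬ G.Adj b z) ∨ (∀ z ∈ O, ¬ G.Adj a z) := by
  by_contra! hc
  obtain ⟨h0, ⟨z, hz, hbz⟩, w, hw, haw⟩ := hc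
  obtain rfl := P.eq_of_adj h hw hz haw hbz
  exact h0 w hw haw hbz

theorem not_two_triangles [Fintype V] (P : DisjointEdges G O a b c d) (h : matchingNumber G = 2)
    (hconn : G.Connected) (hnbr : ∀ w, ∃ z, G.Adj w z) (hO2 : ∃ w ∈ O, ∃ z ∈ O, w ≠ z)
    (hx : ∃ x ∈ O, G.Adj a x ∧ G.Adj b x) (hy : ∃ x ∈ O, G.Adj c x ∧ G.Adj d x) : False := by
  obtain ⟨x, hx, hax, hbx⟩ := hx
  obtain ⟨y, hy, hcy, hdy⟩ := hy
  have ha : ∀ w ∈ O, G.Adj a w → w = x := fun w hw haw => P.eq_of_adj h hw hx haw hbx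
  have hb : ∀ w ∈ O, G.Adj b w → w = x := fun w hw hbw => P.flip.eq_of_adj h hw hx hbw hax
  have hc : ∀ w ∈ O, G.Adj c w → w = y := fun w hw haw => P.swap.eq_of_adj h hw hy haw hdy
  have hd : ∀ w ∈ O, G.Adj d w → w = y := fun w hw hbw => P.swap.flip.eq_of_adj h hw hy hbw hcy
  have hOO : ∀ x ∈ O, ∀ y ∈ O, ¬ G.Adj x y := fun x hx y hy => P.not_adj h hx hy
  have hO := P.mem_iff
  have hxy : x ≠ y := by
    rintro rfl
    have key : ∀ w ∈ O, w = x := by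
      intro w hw
      obtain ⟨t, ht⟩ := hnbr w
      have := ht.symm
      clear hnbr P h hO2
      grind
    obtain ⟨w, hw, z, hz, hwz⟩ := hO2
    exact hwz ((key w hw).trans (key z hz).symm)
  have n1 : ¬ G.Adj a c := P.flip.swap.flip.swap.not_adj_of_adj h hx hy hxy hbx hdy
  have n2 : ¬ G.Adj a d := P.flip.not_adj_of_adj h hx hy hxy hbx hcy
  have n3 : ¬ G.Adj b c := P.swap.flip.swap.not_adj_of_adj h hx hy hxy hax hdy
  have n4 : ¬ G.Adj b d := P.not_adj_of_adj h hx hy hxy hax hcy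
  have hac := P.ac
  have hbc := P.bc
  have hx' := (hO x).1 hx
  obtain ⟨p⟩ := hconn.preconnected a c
  obtain ⟨⟨⟨s, t⟩, hst⟩, -, hs, ht⟩ := p.exists_boundary_dart {a, b, x} (by simp) (by grind)
  simp only [Set.mem_insert_iff, Set.mem_singleton_iff, not_or] at hs ht
  change G.Adj s t at hst
  have hst' := hst.symm
  clear hnbr P h hO2
  grind

end DisjointEdges

/-- A connected graph on at least six vertices with matching number two either has a vertex cover
`{u, v}`, or has a vertex `u` meeting every edge outside some triple `{x, y, z}`. -/
theorem covered_of_matchingNumber {V : Type*} [Fintype V] {G : SimpleGraph V}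
    (hn : 6 ≤ Fintype.card V) (hconn : G.Connected) (h : matchingNumber G = 2) :
    CoveredByTwo G ∨ CoveredByStarAndTriple G := by
  classical
  obtain ⟨a, b, c, d, hab, hcd, hac, had, hbc, hbd⟩ := exists_disjoint_edges_of_matchingNumber h
  have : Nontrivial V := ⟨a, b, hab.ne⟩
  have hnbr : ∀ w, ∃ z, G.Adj w z := hconn.preconnected.exists_adj_of_nontrivial
  have hO2 : ∃ w ∈ {z | z ≠ a ∧ z ≠ b ∧ z ≠ c ∧ z ≠ d},
      ∃ z ∈ {z | z ≠ a ∧ z ≠ b ∧ z ≠ c ∧ z ≠ d}, w ≠ z := by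
    have hc : 1 < (({a, b, c, d} : Finset V)ᶜ).card := by
      rw [Finset.card_compl]
      have := Finset.card_le_four (a := a) (b := b) (c := c) (d := d)
      omega
    obtain ⟨w, hw, z, hz, hwz⟩ := Finset.one_lt_card.1 hc
    exact ⟨w, by simpa using hw, z, by simpa using hz, hwz⟩
  have P : DisjointEdges G {z | z ≠ a ∧ z ≠ b ∧ z ≠ c ∧ z ≠ d} a b c d :=
    ⟨hab, hcd, hac, had, hbc, hbd, fun z => Iff.rfl⟩
  rcases P.triangle_or_single h with k1 | k1 | k1 <;>
    rcases P.swap.triangle_or_single h with k2 | k2 | k2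
  · exact (P.not_two_triangles h hconn hnbr hO2 k1 k2).elim
  · exact Or.inr (P.covered_of_triangle h hnbr hO2 k1 k2)
  · exact Or.inr (P.swap.flip.swap.covered_of_triangle h hnbr hO2 k1 k2)
  · exact Or.inr (P.swap.covered_of_triangle h hnbr hO2 k2 k1)
  · exact P.covered_of_single h hnbr hO2 k1 k2
  · exact P.swap.flip.swap.covered_of_single h hnbr hO2 k1 k2
  · exact Or.inr (P.flip.swap.covered_of_triangle h hnbr hO2 k2 k1)
  · exact P.flip.covered_of_single h hnbr hO2 k1 k2
  · exact P.swap.flip.swap.flip.covered_of_single h hnbr hO2 k1 k2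

/-- The contribution of an edge to the sum-connectivity index. -/
noncomputable def edgeWeight {V : Type*} (G : SimpleGraph V) : Sym2 V → ℝ :=
  Sym2.lift ⟨fun u v => (1 : ℝ) / √((degR G u : ℝ) + (degR G v : ℝ)),
    fun u v => by simp [add_comm]⟩

section Counting

variable {V : Type*} [Fintype V] {G : SimpleGraph V} [DecidableRel G.Adj]

theorem degR_eq_degree (v : V) : degR G v = G.degree v := by
  rw [degR, Set.ncard_eq_toFinset_card', ← SimpleGraph.card_neighborFinset_eq_degree]
  rfl

theorem edgeWeight_mk (u v : V) :
    edgeWeight G s(u, v) = 1 / √((G.degree u : ℝ) + (G.degree v : ℝ)) := by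
  rw [← degR_eq_degree, ← degR_eq_degree]; rfl

theorem sumConn_eq_sum_edgeFinset : sumConn G = ∑ e ∈ G.edgeFinset, edgeWeight G e := by
  unfold sumConn
  refine Finset.sum_congr ?_ fun _ _ => rfl
  ext e
  simp

variable [DecidableEq V]

theorem sum_edgeFinset_eq_star_add {M : Type*} [AddCommMonoid M] (F : Sym2 V → M) (u : V) :
    ∑ e ∈ G.edgeFinset, F e =
      ∑ w ∈ G.neighborFinset u, F s(u, w) + ∑ e ∈ G.edgeFinset with u ∉ e, F e := by
  rw [← Finset.sum_filter_add_sum_filter_not G.edgeFinset (fun e => u ∈ e)]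
  congr 1
  have : G.edgeFinset.filter (fun e => u ∈ e) = (G.neighborFinset u).image (fun w => s(u, w)) := by
    ext e
    induction e with | _ a b
    simp only [Finset.mem_filter, SimpleGraph.mem_edgeFinset, SimpleGraph.mem_edgeSet,
      Sym2.mem_iff, Finset.mem_image, SimpleGraph.mem_neighborFinset]
    constructor
    · rintro ⟨h, rfl | rfl⟩
      · exact ⟨b, h, rfl⟩
      · exact ⟨a, h.symm, Sym2.eq_swap⟩
    · rintro ⟨w, h, hw⟩
      rcases Sym2.eq_iff.1 hw with ⟨rfl, rfl⟩ | ⟨rfl, rfl⟩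
      · exact ⟨h, Or.inl rfl⟩
      · exact ⟨h.symm, Or.inr rfl⟩
  rw [this, Finset.sum_image]
  intro a _ b _ hab
  exact Sym2.congr_right.1 hab

theorem sum_edgeFinset_of_cover {M : Type*} [AddCommMonoid M] (F : Sym2 V → M) {u v : V}
    (huv : u ≠ v) (hcov : ∀ w z, G.Adj w z → w = u ∨ w = v ∨ z = u ∨ z = v) :
    ∑ e ∈ G.edgeFinset, F e = (if G.Adj u v then F s(u, v) else 0) +
      ∑ w ∈ (G.neighborFinset u).erase v, F s(u, w) +
      ∑ w ∈ (G.neighborFinset v).erase u, F s(v, w) := by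
  rw [sum_edgeFinset_eq_star_add F u]
  congr 1
  · split_ifs with h
    · rw [Finset.add_sum_erase _ (fun w => F s(u, w)) (by simpa using h)]
    · rw [zero_add, Finset.erase_eq_of_notMem (by simpa using h)]
  · have : G.edgeFinset.filter (fun e => u ∉ e) =
        ((G.neighborFinset v).erase u).image (fun w => s(v, w)) := by
      ext e
      induction e with | _ a b
      simp only [Finset.mem_filter, SimpleGraph.mem_edgeFinset, SimpleGraph.mem_edgeSet,
        Sym2.mem_iff, Finset.mem_image, SimpleGraph.mem_neighborFinset, Finset.mem_erase, not_or]
      constructor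
      · rintro ⟨h, h1, h2⟩
        rcases hcov a b h with rfl | rfl | rfl | rfl
        · exact (h1 rfl).elim
        · exact ⟨b, ⟨Ne.symm h2, h⟩, rfl⟩
        · exact (h2 rfl).elim
        · exact ⟨a, ⟨Ne.symm h1, h.symm⟩, Sym2.eq_swap⟩
      · rintro ⟨w, ⟨h0, h⟩, hw⟩
        rcases Sym2.eq_iff.1 hw with ⟨rfl, rfl⟩ | ⟨rfl, rfl⟩
        · exact ⟨h, huv, h0.symm⟩
        · exact ⟨h.symm, h0.symm, huv⟩
    rw [this, Finset.sum_image]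
    intro a _ b _ hab
    exact Sym2.congr_right.1 hab

variable {u v : V}

theorem card_edgeFinset_of_cover (huv : u ≠ v)
    (hcov : ∀ w z, G.Adj w z → w = u ∨ w = v ∨ z = u ∨ z = v) :
    G.edgeFinset.card = (if G.Adj u v then 1 else 0) +
      ((G.neighborFinset u).erase v).card + ((G.neighborFinset v).erase u).card := by
  have := sum_edgeFinset_of_cover (G := G) (fun _ => 1) huv hcov
  simpa using this

theorem card_of_cover (huv : u ≠ v) (hcov : ∀ w z, G.Adj w z → w = u ∨ w = v ∨ z = u ∨ z = v)
    (hnbr : ∀ w, ∃ z, G.Adj w z) :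
    Fintype.card V = ((G.neighborFinset u).erase v ∪ (G.neighborFinset v).erase u).card + 2 := by
  have : (G.neighborFinset u).erase v ∪ (G.neighborFinset v).erase u = {u, v}ᶜ := by
    ext w
    have hw := hnbr w
    have h1 := hcov w
    have h2 := G.adj_comm w
    have h3 := G.irrefl (v := w)
    simp only [Finset.mem_union, Finset.mem_erase, SimpleGraph.mem_neighborFinset,
      Finset.mem_compl, Finset.mem_insert, Finset.mem_singleton]
    grind
  have h2 := Finset.card_compl_add_card ({u, v} : Finset V)
  rw [Finset.card_pair huv] at h2
  rw [this, h2]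

theorem degree_eq_one_of_cover (hcov : ∀ w z, G.Adj w z → w = u ∨ w = v ∨ z = u ∨ z = v) {w : V}
    (hw : w ∈ (G.neighborFinset u).erase v \ (G.neighborFinset v).erase u) : G.degree w = 1 := by
  simp only [Finset.mem_sdiff, Finset.mem_erase, SimpleGraph.mem_neighborFinset] at hw
  rw [← SimpleGraph.card_neighborFinset_eq_degree, Finset.card_eq_one]
  refine ⟨u, ?_⟩
  ext z
  have h1 := hcov w z
  have h2 := G.adj_comm w
  have h3 := hw.1.2.ne
  simp only [SimpleGraph.mem_neighborFinset, Finset.mem_singleton]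
  grind

theorem degree_eq_two_of_cover (huv : u ≠ v)
    (hcov : ∀ w z, G.Adj w z → w = u ∨ w = v ∨ z = u ∨ z = v) {w : V}
    (hw : w ∈ (G.neighborFinset u).erase v ∩ (G.neighborFinset v).erase u) : G.degree w = 2 := by
  simp only [Finset.mem_inter, Finset.mem_erase, SimpleGraph.mem_neighborFinset] at hw
  rw [← SimpleGraph.card_neighborFinset_eq_degree, Finset.card_eq_two]
  refine ⟨u, v, huv, ?_⟩
  ext z
  have h1 := hcov w z
  have h2 := G.adj_comm w
  simp only [SimpleGraph.mem_neighborFinset, Finset.mem_insert, Finset.mem_singleton]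
  grind

theorem sum_star_of_cover (huv : u ≠ v)
    (hcov : ∀ w z, G.Adj w z → w = u ∨ w = v ∨ z = u ∨ z = v) :
    ∑ w ∈ (G.neighborFinset u).erase v, edgeWeight G s(u, w) =
      ((G.neighborFinset u).erase v \ (G.neighborFinset v).erase u).card / √(G.degree u + 1) +
      ((G.neighborFinset u).erase v ∩ (G.neighborFinset v).erase u).card / √(G.degree u + 2) := by
  rw [← Finset.sum_inter_add_sum_sdiff _ ((G.neighborFinset v).erase u), add_comm]
  congr 1
  · rw [Finset.sum_congr rfl fun w hw => by
      rw [edgeWeight_mk, degree_eq_one_of_cover hcov hw], Finset.sum_const, nsmul_eq_mul]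
    simp [div_eq_mul_inv]
  · rw [Finset.sum_congr rfl fun w hw => by
      rw [edgeWeight_mk, degree_eq_two_of_cover huv hcov hw], Finset.sum_const, nsmul_eq_mul]
    simp [div_eq_mul_inv]

theorem degree_eq_card_erase_add (u v : V) :
    G.degree u = ((G.neighborFinset u).erase v).card + if G.Adj u v then 1 else 0 := by
  rw [← SimpleGraph.card_neighborFinset_eq_degree]
  split_ifs with h
  · exact (Finset.card_erase_add_one (by simpa using h)).symm
  · rw [Finset.erase_eq_of_notMem (by simpa using h), add_zero]

theorem sumConn_of_cover (huv : u ≠ v)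
    (hcov : ∀ w z, G.Adj w z → w = u ∨ w = v ∨ z = u ∨ z = v) {c p q : ℕ}
    (hr : ((G.neighborFinset u).erase v ∩ (G.neighborFinset v).erase u).card = c)
    (hc : c + (if G.Adj u v then 1 else 0) = 3)
    (hp : ((G.neighborFinset u).erase v \ (G.neighborFinset v).erase u).card = p)
    (hq : ((G.neighborFinset v).erase u \ (G.neighborFinset u).erase v).card = q) :
    sumConn G = (if G.Adj u v then 1 / √((p : ℝ) + q + 6) else 0) +
      starWeight c p + starWeight c q := by
  have hcov' : ∀ w z, G.Adj w z → w = v ∨ w = u ∨ z = v ∨ z = u := fun w z h => by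
    have := hcov w z h; tauto
  have du : G.degree u = p + 3 := by
    rw [degree_eq_card_erase_add u v, ← hc, ← hp, ← hr, ← Finset.card_sdiff_add_card_inter _
      ((G.neighborFinset v).erase u)]
    ring
  have hc' : c + (if G.Adj v u then 1 else 0) = 3 := by
    simpa only [G.adj_comm v u] using hc
  have dv : G.degree v = q + 3 := by
    rw [degree_eq_card_erase_add v u, ← hc', ← hq, ← hr, ← Finset.card_sdiff_add_card_inter _
      ((G.neighborFinset u).erase v), Finset.inter_comm]
    ring
  rw [sumConn_eq_sum_edgeFinset, sum_edgeFinset_of_cover _ huv hcov, sum_star_of_cover huv hcov,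
    sum_star_of_cover huv.symm hcov', Finset.inter_comm ((G.neighborFinset v).erase u), hr, hp, hq,
    edgeWeight_mk, du, dv, starWeight, starWeight, ← add_assoc]
  push_cast
  have e1 : (p : ℝ) + 3 + (q + 3) = p + q + 6 := by ring
  have e2 (t : ℝ) : t + 3 + 1 = t + 4 := by ring
  have e3 (t : ℝ) : t + 3 + 2 = t + 5 := by ring
  rw [e1, e2, e2, e3, e3]
  ring

theorem filter_edgeFinset_of_star_triangle {u x y z : V} (hux : u ≠ x) (huy : u ≠ y) (huz : u ≠ z)
    (hxy : G.Adj x y) (hyz : G.Adj y z) (hxz : G.Adj x z)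
    (hcov : ∀ s t, G.Adj s t → s = u ∨ t = u ∨
      ((s = x ∨ s = y ∨ s = z) ∧ (t = x ∨ t = y ∨ t = z))) :
    G.edgeFinset.filter (fun e => u ∉ e) = {s(x, y), s(y, z), s(x, z)} := by
  ext e
  induction e with | _ a b
  simp only [Finset.mem_filter, SimpleGraph.mem_edgeFinset, SimpleGraph.mem_edgeSet,
    Sym2.mem_iff, Finset.mem_insert, Finset.mem_singleton, Sym2.eq_iff]
  have h1 := hcov a b
  have h2 := fun h : G.Adj a b => h.ne
  have h3 := G.adj_comm
  grind

/-- The case of a star at `u` together with a triangle `xyz`, where `u` is adjacent to all vertices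
but `x`. -/
theorem sumConn_of_star_triangle {u x y z : V} (hux : u ≠ x) (huy : u ≠ y) (huz : u ≠ z)
    (hxy : G.Adj x y) (hyz : G.Adj y z) (hxz : G.Adj x z)
    (hcov : ∀ s t, G.Adj s t → s = u ∨ t = u ∨
      ((s = x ∨ s = y ∨ s = z) ∧ (t = x ∨ t = y ∨ t = z)))
    (hu : ∀ w, G.Adj u w ↔ w ≠ u ∧ w ≠ x) {m : ℕ} (hm : Fintype.card V = m + 4) :
    sumConn G = m / √(m + 3) + 2 / √((m : ℝ) + 5) + (1 / √6 + 2 / √5) := by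
  have hxy' := hxy.ne
  have hyz' := hyz.ne
  have hxz' := hxz.ne
  have hN : G.neighborFinset u = insert y (insert z ({u, x, y, z} : Finset V)ᶜ) := by
    ext w
    simp only [SimpleGraph.mem_neighborFinset, hu, Finset.mem_insert, Finset.mem_compl,
      Finset.mem_singleton]
    grind
  have hL : (({u, x, y, z} : Finset V)ᶜ).card = m := by
    have h4 : ({u, x, y, z} : Finset V).card = 4 := by
      simp [hux, huy, huz, hxy', hyz', hxz']
    have := Finset.card_compl_add_card ({u, x, y, z} : Finset V)
    omega
  have hy : y ∉ insert z ({u, x, y, z} : Finset V)ᶜ := by simp [hyz']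
  have hz : z ∉ ({u, x, y, z} : Finset V)ᶜ := by simp
  have du : G.degree u = m + 2 := by
    rw [← SimpleGraph.card_neighborFinset_eq_degree, hN, Finset.card_insert_of_notMem hy,
      Finset.card_insert_of_notMem hz, hL]
  have dx : G.degree x = 2 := by
    rw [← SimpleGraph.card_neighborFinset_eq_degree, Finset.card_eq_two]
    refine ⟨y, z, hyz', ?_⟩
    ext w
    have h1 := hcov x w
    have h3 := G.adj_comm x
    have h4 := G.irrefl (v := x)
    simp only [SimpleGraph.mem_neighborFinset, Finset.mem_insert, Finset.mem_singleton]
    grind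
  have dy : G.degree y = 3 := by
    rw [← SimpleGraph.card_neighborFinset_eq_degree, Finset.card_eq_three]
    refine ⟨u, x, z, hux, huz, hxz', ?_⟩
    ext w
    have h1 := hcov y w
    have h3 := G.adj_comm y
    have h4 := G.irrefl (v := y)
    simp only [SimpleGraph.mem_neighborFinset, Finset.mem_insert, Finset.mem_singleton]
    grind
  have dz : G.degree z = 3 := by
    rw [← SimpleGraph.card_neighborFinset_eq_degree, Finset.card_eq_three]
    refine ⟨u, x, y, hux, huy, hxy', ?_⟩
    ext w
    have h1 := hcov z w
    have h3 := G.adj_comm z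
    have h4 := G.irrefl (v := z)
    simp only [SimpleGraph.mem_neighborFinset, Finset.mem_insert, Finset.mem_singleton]
    grind
  have dL : ∀ w ∈ ({u, x, y, z} : Finset V)ᶜ, G.degree w = 1 := by
    intro w hw
    simp only [Finset.mem_compl, Finset.mem_insert, Finset.mem_singleton, not_or] at hw
    rw [← SimpleGraph.card_neighborFinset_eq_degree, Finset.card_eq_one]
    refine ⟨u, ?_⟩
    ext t
    have h1 := hcov w t
    have h3 := G.adj_comm w
    simp only [SimpleGraph.mem_neighborFinset, Finset.mem_singleton]
    grind
  rw [sumConn_eq_sum_edgeFinset, sum_edgeFinset_eq_star_add _ u,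
    filter_edgeFinset_of_star_triangle hux huy huz hxy hyz hxz hcov, hN,
    Finset.sum_insert hy, Finset.sum_insert hz,
    Finset.sum_congr rfl fun w hw => by rw [edgeWeight_mk, dL w hw], Finset.sum_const, hL,
    nsmul_eq_mul, Finset.sum_insert, Finset.sum_insert, Finset.sum_singleton]
  · simp only [edgeWeight_mk, du, dx, dy, dz]
    push_cast
    have e1 : (m : ℝ) + 2 + 3 = m + 5 := by ring
    have e2 : (m : ℝ) + 2 + 1 = m + 3 := by ring
    have e3 : (2 : ℝ) + 3 = 5 := by norm_num
    have e4 : (3 : ℝ) + 3 = 6 := by norm_num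
    rw [e1, e2, e3, e4]
    ring
  · simp only [Finset.mem_singleton, Sym2.eq_iff]; grind
  · simp only [Finset.mem_insert, Finset.mem_singleton, Sym2.eq_iff]; grind

end Counting

theorem sumConn_eq_of_iso {V W : Type*} [Fintype V] [Fintype W] {G : SimpleGraph V}
    {H : SimpleGraph W} (φ : G ≃g H) : sumConn G = sumConn H := by
  classical
  rw [sumConn_eq_sum_edgeFinset, sumConn_eq_sum_edgeFinset]
  refine Finset.sum_bij (fun e _ => e.map φ) (fun e he => ?_) (fun e _ f _ h => ?_) (fun e he => ?_)
    fun e _ => ?_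
  · induction e with | _ a b
    simpa [SimpleGraph.Iso.map_adj_iff] using he
  · exact Sym2.map.injective φ.injective h
  · induction e with | _ a b
    refine ⟨s(φ.symm a, φ.symm b), ?_, by simp⟩
    simpa [SimpleGraph.Iso.map_adj_iff] using he
  · induction e with | _ a b
    simp [edgeWeight_mk]

namespace BabVert

variable {a b : ℕ}

/-- A vertex of the four-vertex bicyclic graph in `B_n(a, b)`. -/
def core (i : Fin 4) : BabVert a b := Sum.inl i

/-- A pendent vertex attached to the core vertex `0`. -/
def leaf₀ (i : Fin (a - 3)) : BabVert a b := Sum.inr (Sum.inl i)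

/-- A pendent vertex attached to the core vertex `1`. -/
def leaf₁ (i : Fin (b - 3)) : BabVert a b := Sum.inr (Sum.inr i)

theorem exists_eq (w : BabVert a b) :
    (∃ i, w = core i) ∨ (∃ i, w = leaf₀ i) ∨ ∃ i, w = leaf₁ i := by
  rcases w with i | i | i
  exacts [Or.inl ⟨i, rfl⟩, Or.inr (Or.inl ⟨i, rfl⟩), Or.inr (Or.inr ⟨i, rfl⟩)]

@[simp] theorem core_inj {i j : Fin 4} : (core i : BabVert a b) = core j ↔ i = j :=
  Sum.inl_injective.eq_iff

@[simp] theorem leaf₀_inj {i j : Fin (a - 3)} : (leaf₀ i : BabVert a b) = leaf₀ j ↔ i = j :=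
  (Sum.inr_injective.comp Sum.inl_injective).eq_iff

@[simp] theorem leaf₁_inj {i j : Fin (b - 3)} : (leaf₁ i : BabVert a b) = leaf₁ j ↔ i = j :=
  (Sum.inr_injective.comp Sum.inr_injective).eq_iff

@[simp] theorem core_ne_leaf₀ (i : Fin 4) (j : Fin (a - 3)) : (core i : BabVert a b) ≠ leaf₀ j :=
  Sum.inl_ne_inr

@[simp] theorem core_ne_leaf₁ (i : Fin 4) (j : Fin (b - 3)) : (core i : BabVert a b) ≠ leaf₁ j :=
  Sum.inl_ne_inr

@[simp] theorem leaf₀_ne_leaf₁ (i : Fin (a - 3)) (j : Fin (b - 3)) :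
    (leaf₀ i : BabVert a b) ≠ leaf₁ j :=
  fun h => Sum.inl_ne_inr (Sum.inr_injective h)

@[simp] theorem leaf₀_ne_core (i : Fin 4) (j : Fin (a - 3)) : (leaf₀ j : BabVert a b) ≠ core i :=
  Sum.inr_ne_inl

@[simp] theorem leaf₁_ne_core (i : Fin 4) (j : Fin (b - 3)) : (leaf₁ j : BabVert a b) ≠ core i :=
  Sum.inr_ne_inl

@[simp] theorem leaf₁_ne_leaf₀ (i : Fin (a - 3)) (j : Fin (b - 3)) :
    (leaf₁ j : BabVert a b) ≠ leaf₀ i :=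
  (leaf₀_ne_leaf₁ i j).symm

theorem adj_iff (s t : BabVert a b) :
    (BabGraph a b).Adj s t ↔ s ≠ t ∧ (BabRel a b s t ∨ BabRel a b t s) :=
  SimpleGraph.fromRel_adj _ _ _

@[simp] theorem adj_core_core (i j : Fin 4) :
    (BabGraph a b).Adj (core i) (core j) ↔ i ≠ j ∧ (i < 2 ∨ j < 2) := by
  rw [adj_iff, Ne, core_inj]
  simp only [BabRel, core]
  revert i j
  decide

@[simp] theorem adj_core_leaf₀ (i : Fin 4) (j : Fin (a - 3)) :
    (BabGraph a b).Adj (core i) (leaf₀ j) ↔ i = 0 := by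
  rw [adj_iff]
  change _ ∧ (i = 0 ∨ False) ↔ _
  simp

@[simp] theorem adj_core_leaf₁ (i : Fin 4) (j : Fin (b - 3)) :
    (BabGraph a b).Adj (core i) (leaf₁ j) ↔ i = 1 := by
  rw [adj_iff]
  change _ ∧ (i = 1 ∨ False) ↔ _
  simp

@[simp] theorem adj_leaf₀_core (i : Fin 4) (j : Fin (a - 3)) :
    (BabGraph a b).Adj (leaf₀ j) (core i) ↔ i = 0 := by
  rw [SimpleGraph.adj_comm, adj_core_leaf₀]

@[simp] theorem adj_leaf₁_core (i : Fin 4) (j : Fin (b - 3)) :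
    (BabGraph a b).Adj (leaf₁ j) (core i) ↔ i = 1 := by
  rw [SimpleGraph.adj_comm, adj_core_leaf₁]

@[simp] theorem not_adj_leaf₀_leaf₀ (i j : Fin (a - 3)) :
    ¬ (BabGraph a b).Adj (leaf₀ i) (leaf₀ j) := by
  rw [adj_iff]
  change ¬ (_ ∧ (False ∨ False))
  simp

@[simp] theorem not_adj_leaf₁_leaf₁ (i j : Fin (b - 3)) :
    ¬ (BabGraph a b).Adj (leaf₁ i) (leaf₁ j) := by
  rw [adj_iff]
  change ¬ (_ ∧ (False ∨ False))
  simp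

@[simp] theorem not_adj_leaf₀_leaf₁ (i : Fin (a - 3)) (j : Fin (b - 3)) :
    ¬ (BabGraph a b).Adj (leaf₀ i) (leaf₁ j) := by
  rw [adj_iff]
  change ¬ (_ ∧ (False ∨ False))
  simp

@[simp] theorem not_adj_leaf₁_leaf₀ (i : Fin (a - 3)) (j : Fin (b - 3)) :
    ¬ (BabGraph a b).Adj (leaf₁ j) (leaf₀ i) := fun h => not_adj_leaf₀_leaf₁ i j h.symm

theorem cover (w z : BabVert a b) (h : (BabGraph a b).Adj w z) :
    w = core 0 ∨ w = core 1 ∨ z = core 0 ∨ z = core 1 := by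
  have key : ∀ i : Fin 4, i < 2 → i = 0 ∨ i = 1 := by decide
  rcases exists_eq w with ⟨i, rfl⟩ | ⟨i, rfl⟩ | ⟨i, rfl⟩ <;>
    rcases exists_eq z with ⟨j, rfl⟩ | ⟨j, rfl⟩ | ⟨j, rfl⟩ <;> simp at h ⊢
  · have := key i
    have := key j
    tauto
  all_goals tauto

end BabVert

open BabVert in
theorem sumConn_babGraph (p q : ℕ) :
    sumConn (BabGraph (p + 3) (q + 3)) =
      1 / √((p : ℝ) + q + 6) + starWeight 2 p + starWeight 2 q := by
  classical
  have hadj : (BabGraph (p + 3) (q + 3)).Adj (core 0) (core 1) := by simp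
  rw [sumConn_of_cover (u := core 0) (v := core 1) (c := 2) (p := p) (q := q) (by simp)
    cover ?_ ?_ ?_ ?_, if_pos hadj]
  · norm_num
  · rw [Finset.card_eq_two]
    refine ⟨core 2, core 3, by simp, ?_⟩
    ext w
    rcases exists_eq w with ⟨i, rfl⟩ | ⟨i, rfl⟩ | ⟨i, rfl⟩
    · revert i
      simp
      decide
    · simp
    · simp
  · rw [if_pos hadj]
  · trans (Finset.univ.image (leaf₀ (a := p + 3) (b := q + 3))).card
    · congr 1
      ext w
      rcases exists_eq w with ⟨i, rfl⟩ | ⟨i, rfl⟩ | ⟨i, rfl⟩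
      · revert i
        simp
        decide
      · simp
      · simp
    · rw [Finset.card_image_of_injective _ fun i j h => leaf₀_inj.1 h]
      simp
  · trans (Finset.univ.image (leaf₁ (a := p + 3) (b := q + 3))).card
    · congr 1
      ext w
      rcases exists_eq w with ⟨i, rfl⟩ | ⟨i, rfl⟩ | ⟨i, rfl⟩
      · revert i
        simp
        decide
      · simp
      · simp
    · rw [Finset.card_image_of_injective _ fun i j h => leaf₁_inj.1 h]
      simp

open BabVert in
theorem nonempty_iso_babGraph {V : Type*} [Fintype V] [DecidableEq V] {G : SimpleGraph V}
    [DecidableRel G.Adj] {u v : V} (hadj : G.Adj u v)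
    (hcov : ∀ w z, G.Adj w z → w = u ∨ w = v ∨ z = u ∨ z = v) {p q : ℕ}
    (hcard : Fintype.card V = p + q + 4)
    (hr : ((G.neighborFinset u).erase v ∩ (G.neighborFinset v).erase u).card = 2)
    (hp : ((G.neighborFinset u).erase v \ (G.neighborFinset v).erase u).card = p)
    (hq : ((G.neighborFinset v).erase u \ (G.neighborFinset u).erase v).card = q) :
    Nonempty (G ≃g BabGraph (p + 3) (q + 3)) := by
  obtain ⟨x, y, hxy, hR⟩ := Finset.card_eq_two.1 hr
  let eP := (Finset.equivFinOfCardEq hp).symm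
  let eQ := (Finset.equivFinOfCardEq hq).symm
  have hP (i) : (eP i : V) ≠ v ∧ G.Adj u (eP i) ∧ ¬ G.Adj v (eP i) := by
    have := (eP i).2
    simp only [Finset.mem_sdiff, Finset.mem_erase, SimpleGraph.mem_neighborFinset] at this
    have h2 := this.1.2.ne
    tauto
  have hQ (i) : (eQ i : V) ≠ u ∧ G.Adj v (eQ i) ∧ ¬ G.Adj u (eQ i) := by
    have := (eQ i).2
    simp only [Finset.mem_sdiff, Finset.mem_erase, SimpleGraph.mem_neighborFinset] at this
    have h2 := this.1.2.ne
    tauto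
  have hR' (w) : (w = x ∨ w = y) ↔ G.Adj u w ∧ G.Adj v w := by
    have := Finset.ext_iff.1 hR w
    simp only [Finset.mem_inter, Finset.mem_erase, SimpleGraph.mem_neighborFinset,
      Finset.mem_insert, Finset.mem_singleton] at this
    rw [← this]
    have h1 := fun h : G.Adj u w => h.ne
    have h2 := fun h : G.Adj v w => h.ne
    grind
  have hx := (hR' x).1 (Or.inl rfl)
  have hy := (hR' y).1 (Or.inr rfl)
  have huv := hadj.ne
  let g : Fin 4 → V := ![u, v, x, y]
  let f : BabVert (p + 3) (q + 3) → V :=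
    Sum.elim g (Sum.elim (fun i => (eP i : V)) (fun i => (eQ i : V)))
  have fc (i) : f (core i) = g i := rfl
  have fP (i) : f (leaf₀ i) = eP i := rfl
  have fQ (i) : f (leaf₁ i) = eQ i := rfl
  have hg : Function.Injective g := by
    have := hx.1.ne
    have := hx.2.ne
    have := hy.1.ne
    have := hy.2.ne
    clear_value eP eQ
    clear hP hQ hR' fc fP fQ f
    intro i j hij
    fin_cases i <;> fin_cases j <;> simp [g] at hij ⊢ <;> grind
  have hgP (i k) : G.Adj (g i) (eP k) ↔ i = 0 := by
    obtain ⟨h1, h2, h3⟩ := hP k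
    have key (w) (hw : w ≠ u ∧ w ≠ v) : ¬ G.Adj w (eP k) := fun h => by
      have := hcov _ _ h
      have := h2.ne
      grind
    fin_cases i
    · simpa [g] using h2
    · simpa [g] using h3
    · simpa [g] using key x ⟨hx.1.ne', hx.2.ne'⟩
    · simpa [g] using key y ⟨hy.1.ne', hy.2.ne'⟩
  have hgQ (i k) : G.Adj (g i) (eQ k) ↔ i = 1 := by
    obtain ⟨h1, h2, h3⟩ := hQ k
    have key (w) (hw : w ≠ u ∧ w ≠ v) : ¬ G.Adj w (eQ k) := fun h => by
      have := hcov _ _ h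
      have := h2.ne
      grind
    fin_cases i
    · simpa [g] using h3
    · simpa [g] using h2
    · simpa [g] using key x ⟨hx.1.ne', hx.2.ne'⟩
    · simpa [g] using key y ⟨hy.1.ne', hy.2.ne'⟩
  have hgg (i j) : G.Adj (g i) (g j) ↔ i ≠ j ∧ (i < 2 ∨ j < 2) := by
    have nxy : ¬ G.Adj x y := fun h => by
      have := hcov _ _ h
      have := hx.1.ne
      have := hx.2.ne
      have := hy.1.ne
      have := hy.2.ne
      grind
    have nyx : ¬ G.Adj y x := fun h => nxy h.symm
    fin_cases i <;> fin_cases j <;>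
      simp [g, hadj, hadj.symm, hx.1, hx.2, hx.1.symm, hx.2.symm, hy.1, hy.2, hy.1.symm, hy.2.symm,
        nxy, nyx]
  have hPP (w z) (hw : w ≠ u ∧ w ≠ v) (hz : z ≠ u ∧ z ≠ v) : ¬ G.Adj w z := fun h => by
    have := hcov _ _ h; tauto
  have hP' (i) : (eP i : V) ≠ u ∧ (eP i : V) ≠ v := ⟨(hP i).2.1.ne', (hP i).1⟩
  have hQ' (i) : (eQ i : V) ≠ u ∧ (eQ i : V) ≠ v := ⟨(hQ i).1, (hQ i).2.1.ne'⟩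
  have hinj : Function.Injective f := by
    refine hg.sumElim (Function.Injective.sumElim (Subtype.val_injective.comp eP.injective)
      (Subtype.val_injective.comp eQ.injective) fun i j h => ?_) fun i j h => ?_
    · exact (hP i).2.2 (h ▸ (hQ j).2.1)
    · rcases j with j | j
      · have h1 := (hgP 1 j).not.2 (by decide)
        rw [Sum.elim_inl] at h
        rw [← h, hgg] at h1
        have h2 : i ≠ 1 := by rintro rfl; exact (hP' j).2 h.symm
        exact h1 ⟨h2.symm, Or.inl (by decide)⟩
      · have h1 := (hgQ 0 j).not.2 (by decide)
        rw [Sum.elim_inr] at h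
        rw [← h, hgg] at h1
        have h2 : i ≠ 0 := by rintro rfl; exact (hQ' j).1 h.symm
        exact h1 ⟨h2.symm, Or.inl (by decide)⟩
  have hbij : Function.Bijective f := by
    rw [Fintype.bijective_iff_injective_and_card]
    refine ⟨hinj, ?_⟩
    rw [hcard]
    change Fintype.card (Fin 4 ⊕ Fin p ⊕ Fin q) = _
    simp only [Fintype.card_sum, Fintype.card_fin]
    ring
  refine ⟨RelIso.symm ⟨Equiv.ofBijective f hbij, fun {s t} => ?_⟩⟩
  rw [Equiv.ofBijective_apply, Equiv.ofBijective_apply]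
  rcases exists_eq s with ⟨i, rfl⟩ | ⟨i, rfl⟩ | ⟨i, rfl⟩ <;>
    rcases exists_eq t with ⟨j, rfl⟩ | ⟨j, rfl⟩ | ⟨j, rfl⟩ <;> simp only [fc, fP, fQ]
  · rw [hgg, adj_core_core]
  · rw [hgP, adj_core_leaf₀]
  · rw [hgQ, adj_core_leaf₁]
  · rw [G.adj_comm, hgP, adj_leaf₀_core]
  · simpa using hPP _ _ (hP' i) (hP' j)
  · simpa using hPP _ _ (hP' i) (hQ' j)
  · rw [G.adj_comm, hgQ, adj_leaf₁_core]
  · simpa using hPP _ _ (hQ' i) (hP' j)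
  · simpa using hPP _ _ (hQ' i) (hQ' j)

theorem sumConn_babGraph_four (s : ℕ) :
    sumConn (BabGraph (s + 3) 4) =
      1 / √((s : ℝ) + 7) + 2 / √((s : ℝ) + 5) + s / √((s : ℝ) + 4) + 2 / √6 + 1 / √5 := by
  have := sumConn_babGraph s 1
  rw [this, starWeight, starWeight, Nat.cast_one]
  norm_num only [add_assoc]
  ring

section Comparison

variable {V : Type*} [Fintype V] [DecidableEq V] {G : SimpleGraph V} [DecidableRel G.Adj] {s : ℕ}

theorem iso_or_lt_sumConn_of_cover {u v : V} (hcard : Fintype.card V = s + 5)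
    (hedges : G.edgeFinset.card = s + 6) (hnbr : ∀ w, ∃ z, G.Adj w z)
    (hnot : ¬ Nonempty (G ≃g BabGraph (s + 4) 3)) (huv : u ≠ v)
    (hcov : ∀ w z, G.Adj w z → w = u ∨ w = v ∨ z = u ∨ z = v) :
    Nonempty (G ≃g BabGraph (s + 3) 4) ∨ sumConn (BabGraph (s + 3) 4) < sumConn G := by
  have hcov' : ∀ w z, G.Adj w z → w = v ∨ w = u ∨ z = v ∨ z = u := fun w z h => by
    have := hcov w z h; tauto
  have h1 := card_of_cover huv hcov hnbr
  have h2 := card_edgeFinset_of_cover huv hcov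
  obtain ⟨r, hr⟩ : ∃ r, ((G.neighborFinset u).erase v ∩ (G.neighborFinset v).erase u).card = r :=
    ⟨_, rfl⟩
  obtain ⟨p, hp⟩ : ∃ p, ((G.neighborFinset u).erase v \ (G.neighborFinset v).erase u).card = p :=
    ⟨_, rfl⟩
  obtain ⟨q, hq⟩ : ∃ q, ((G.neighborFinset v).erase u \ (G.neighborFinset u).erase v).card = q :=
    ⟨_, rfl⟩
  have hr' := hr
  rw [Finset.inter_comm] at hr'
  have h3 := Finset.card_sdiff_add_card_inter ((G.neighborFinset u).erase v)
    ((G.neighborFinset v).erase u)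
  have h4 := Finset.card_sdiff_add_card_inter ((G.neighborFinset v).erase u)
    ((G.neighborFinset u).erase v)
  have h5 := Finset.card_union_add_card_inter ((G.neighborFinset u).erase v)
    ((G.neighborFinset v).erase u)
  have hc : r + (if G.Adj u v then 1 else 0) = 3 := by omega
  have hsum := sumConn_of_cover huv hcov hr hc hp hq
  have hmem (k : ℕ) : (k : ℝ) ∈ Set.Ioi (-1 : ℝ) := by
    have := k.cast_nonneg (α := ℝ)
    simp only [Set.mem_Ioi]
    linarith
  by_cases huv' : G.Adj u v
  · rw [if_pos huv'] at hc h2 hsum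
    obtain rfl : r = 2 := by omega
    have hiso := nonempty_iso_babGraph huv' hcov (by omega) hr hp hq
    have hiso' := nonempty_iso_babGraph huv'.symm hcov' (by omega) hr' hq hp
    rcases lt_or_ge 1 p with hp1 | hp1
    · rcases lt_or_ge 1 q with hq1 | hq1
      · right
        rw [hsum, sumConn_babGraph s 1]
        have hpq : (p : ℝ) + q = s + 1 := by norm_cast; omega
        have := (strictConcaveOn_starWeight (c := 2) (by norm_num)).add_lt_add_of_sum_eq
          (hmem 1) (hmem s) (p := p) (q := q) (by exact_mod_cast hp1) (by exact_mod_cast hq1)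
          (by push_cast; linarith)
        rw [hpq]
        push_cast at this ⊢
        linarith
      · interval_cases q
        · exact (hnot ((show p + 3 = s + 4 by omega) ▸ hiso)).elim
        · exact Or.inl ((show p + 3 = s + 3 by omega) ▸ hiso)
    · interval_cases p
      · exact (hnot ((show q + 3 = s + 4 by omega) ▸ hiso')).elim
      · exact Or.inl ((show q + 3 = s + 3 by omega) ▸ hiso')
  · right
    rw [if_neg huv'] at hc h2 hsum
    obtain rfl : r = 3 := by omega
    have hpq : (p : ℝ) + q = s := by norm_cast; omega
    have key : starWeight 3 0 + starWeight 3 s ≤ starWeight 3 p + starWeight 3 q := by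
      rcases p.eq_zero_or_pos with rfl | hp0
      · rw [← hpq]; simp
      rcases q.eq_zero_or_pos with rfl | hq0
      · rw [← hpq]; simp [add_comm]
      have := (strictConcaveOn_starWeight (c := 3) (by norm_num)).add_lt_add_of_sum_eq
          (hmem 0) (hmem s) (p := p) (q := q) (by exact_mod_cast hp0) (by exact_mod_cast hq0)
          (by push_cast; linarith)
      rw [Nat.cast_zero] at this
      exact this.le
    rw [hsum, sumConn_babGraph_four]
    have i1 : 1 / √((s : ℝ) + 7) < 1 / √((s : ℝ) + 5) := inv_sqrt_lt (by positivity) (by linarith)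
    have i2 : 1 / √(6 : ℝ) < 1 / √5 := inv_sqrt_lt (by norm_num) (by norm_num)
    rw [starWeight, starWeight, zero_div, zero_add, zero_add] at key
    push_cast
    have j (x t : ℝ) : t / √x = t * (1 / √x) := by ring
    rw [j _ 3, j _ 3, j _ s] at key
    rw [j _ s, j _ 2, j _ 2]
    linarith

theorem lt_sumConn_of_star_triangle {u x y z : V} (hcard : Fintype.card V = s + 5)
    (hedges : G.edgeFinset.card = s + 6) (hnbr : ∀ w, ∃ z, G.Adj w z)
    (hux : u ≠ x) (huy : u ≠ y) (huz : u ≠ z)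
    (hxy : G.Adj x y) (hyz : G.Adj y z) (hxz : G.Adj x z)
    (hcov : ∀ s t, G.Adj s t → s = u ∨ t = u ∨
      ((s = x ∨ s = y ∨ s = z) ∧ (t = x ∨ t = y ∨ t = z))) :
    sumConn (BabGraph (s + 3) 4) < sumConn G := by
  have hN : (G.neighborFinset u).card = s + 3 := by
    have h := sum_edgeFinset_eq_star_add (G := G) (fun _ => 1) u
    have h3 : (G.edgeFinset.filter (fun e => u ∉ e)).card = 3 := by
      rw [filter_edgeFinset_of_star_triangle hux huy huz hxy hyz hxz hcov, Finset.card_eq_three]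
      have := hxy.ne
      have := hyz.ne
      have := hxz.ne
      refine ⟨_, _, _, ?_, ?_, ?_, rfl⟩ <;> simp only [ne_eq, Sym2.eq_iff] <;> grind
    simp only [Finset.sum_const, smul_eq_mul, mul_one] at h
    omega
  obtain ⟨t, ht⟩ : ∃ t, (insert u (G.neighborFinset u))ᶜ = {t} := by
    rw [← Finset.card_eq_one, Finset.card_compl, Finset.card_insert_of_notMem (by simp)]
    omega
  have hu : ∀ w, G.Adj u w ↔ w ≠ u ∧ w ≠ t := fun w => by
    have h1 := Finset.ext_iff.1 ht w
    simp only [Finset.mem_compl, Finset.mem_insert, SimpleGraph.mem_neighborFinset,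
      Finset.mem_singleton] at h1
    have h2 := fun h : G.Adj u w => h.ne
    grind
  have htxyz : t = x ∨ t = y ∨ t = z := by
    obtain ⟨w, hw⟩ := hnbr t
    have h1 := (hu t).not.2 (by tauto)
    have h2 : t ≠ u := by
      have := Finset.ext_iff.1 ht t
      simp at this
      tauto
    rcases hcov t w hw with h | rfl | h
    · exact (h2 h).elim
    · exact (h1 hw.symm).elim
    · exact h.1
  have hm : Fintype.card V = (s + 1) + 4 := hcard
  have hsum : sumConn G = (s + 1 : ℕ) / √((s + 1 : ℕ) + 3) + 2 / √(((s + 1 : ℕ) : ℝ) + 5) +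
      (1 / √6 + 2 / √5) := by
    rcases htxyz with rfl | rfl | rfl
    · exact sumConn_of_star_triangle hux huy huz hxy hyz hxz hcov hu hm
    · refine sumConn_of_star_triangle huy hux huz hxy.symm hxz hyz (fun s t h => ?_) hu hm
      have := hcov s t h
      tauto
    · refine sumConn_of_star_triangle huz huy hux hyz.symm hxy.symm hxz.symm (fun s t h => ?_) hu hm
      have := hcov s t h
      tauto
  rw [hsum, sumConn_babGraph_four]
  have i1 : 1 / √((s : ℝ) + 7) < 1 / √((s : ℝ) + 6) := inv_sqrt_lt (by positivity) (by linarith)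
  have i2 : 1 / √(6 : ℝ) < 1 / √5 := inv_sqrt_lt (by norm_num) (by norm_num)
  have i3 := two_mul_inv_sqrt_le (x := (s : ℝ) + 5) (by linarith [s.cast_nonneg (α := ℝ)])
  rw [show (s : ℝ) + 5 - 1 = s + 4 by ring, show (s : ℝ) + 5 + 1 = s + 6 by ring] at i3
  push_cast
  rw [show (s : ℝ) + 1 + 3 = s + 4 by ring, show (s : ℝ) + 1 + 5 = s + 6 by ring]
  have j (x t : ℝ) : t / √x = t * (1 / √x) := by ring
  rw [j _ 2] at i3
  rw [j _ 2, j _ 2, j _ 2, j _ 2, j _ s, j _ (s + 1)]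
  linarith

theorem iso_or_lt_sumConn (hs : 1 ≤ s) (hcard : Fintype.card V = s + 5) (hconn : G.Connected)
    (hedges : G.edgeFinset.card = s + 6) (hmatch : matchingNumber G = 2)
    (hnot : ¬ Nonempty (G ≃g BabGraph (s + 4) 3)) :
    Nonempty (G ≃g BabGraph (s + 3) 4) ∨ sumConn (BabGraph (s + 3) 4) < sumConn G := by
  have : Nontrivial V := Fintype.one_lt_card_iff_nontrivial.1 (by omega)
  have hnbr : ∀ w, ∃ z, G.Adj w z := fun w => hconn.preconnected.exists_adj_of_nontrivial w
  rcases covered_of_matchingNumber (by omega) hconn hmatch with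
    ⟨u, v, huv, hcov⟩ | ⟨u, x, y, z, hux, huy, huz, hxy, hyz, hxz, hcov⟩
  · exact iso_or_lt_sumConn_of_cover hcard hedges hnbr hnot huv hcov
  · have h3 := G.adj_comm
    have h4 := fun w => G.irrefl (v := w)
    by_cases axy : G.Adj x y
    · by_cases ayz : G.Adj y z
      · by_cases axz : G.Adj x z
        · exact Or.inr (lt_sumConn_of_star_triangle hcard hedges hnbr hux huy huz axy ayz axz hcov)
        · refine iso_or_lt_sumConn_of_cover hcard hedges hnbr hnot huy fun w t h => ?_
          have := hcov w t h
          grind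
      · refine iso_or_lt_sumConn_of_cover hcard hedges hnbr hnot hux fun w t h => ?_
        have := hcov w t h
        grind
    · refine iso_or_lt_sumConn_of_cover hcard hedges hnbr hnot huz fun w t h => ?_
      have := hcov w t h
      grind

end Comparison

/-- Let `n ≥ 6` and let `G` be a bicyclic graph with `n` vertices and matching number
`2` that is not isomorphic to `B_n(n−1, 3)`. Then
`χ(G) ≥ 1/√(n+2) + 2/√n + (n−5)/√(n−1) + 2/√6 + 1/√5`, with equality if and only if
`G ≅ B_n(n−2, 4)`. -/
theorem stmt_8 {V : Type*} [Fintype V] (G : SimpleGraph V) (n : ℕ) (hn : 6 ≤ n)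
    (hcard : Fintype.card V = n) (hconn : G.Connected)
    (hedges : G.edgeSet.ncard = n + 1)
    (hmatch : matchingNumber G = 2)
    (hnot : ¬ Nonempty (G ≃g BabGraph (n - 1) 3)) :
    sumConn G ≥ 1 / Real.sqrt ((n : ℝ) + 2) + 2 / Real.sqrt (n : ℝ) +
        ((n : ℝ) - 5) / Real.sqrt ((n : ℝ) - 1) + 2 / Real.sqrt 6 + 1 / Real.sqrt 5 ∧
    (sumConn G = 1 / Real.sqrt ((n : ℝ) + 2) + 2 / Real.sqrt (n : ℝ) +
        ((n : ℝ) - 5) / Real.sqrt ((n : ℝ) - 1) + 2 / Real.sqrt 6 + 1 / Real.sqrt 5 ↔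
      Nonempty (G ≃g BabGraph (n - 2) 4)) := by
  classical
  obtain ⟨s, rfl⟩ : ∃ s, n = s + 5 := ⟨n - 5, by omega⟩
  have hedges' : G.edgeFinset.card = s + 6 := by
    rw [SimpleGraph.edgeFinset, ← Set.ncard_eq_toFinset_card', hedges]
  have hT : 1 / √(((s + 5 : ℕ) : ℝ) + 2) + 2 / √((s + 5 : ℕ) : ℝ) +
      (((s + 5 : ℕ) : ℝ) - 5) / √(((s + 5 : ℕ) : ℝ) - 1) + 2 / √6 + 1 / √5 =
      sumConn (BabGraph (s + 3) 4) := by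
    rw [sumConn_babGraph_four]
    push_cast
    rw [show (s : ℝ) + 5 + 2 = s + 7 by ring, show (s : ℝ) + 5 - 1 = s + 4 by ring,
      add_sub_cancel_right]
  rw [hT]
  have hiff : Nonempty (G ≃g BabGraph (s + 3) 4) → sumConn G = sumConn (BabGraph (s + 3) 4) :=
    fun ⟨φ⟩ => sumConn_eq_of_iso φ
  rcases iso_or_lt_sumConn (by omega) hcard hconn hedges' hmatch hnot with h | h
  · exact ⟨(hiff h).ge, fun _ => h, hiff⟩
  · exact ⟨h.le, fun h' => (h.ne' h').elim, hiff⟩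
end

section
/- For integers a ≥ b ≥ 4, one has (a−4)/√(a+2) − (a−3)/√(a+1) + 2/√(a+3) < (b−5)/√(b+1) − (b−4)/√b + 2/√(b+2). Consequently, χ(B_n(a,b)) > χ(B_n(a+1,b−1)) whenever a ≥ b ≥ 4 and a + b = n + 2. -/
open SimpleGraph

lemma one_div_sqrt_le {y z q : ℝ} (hy : 0 < y) (hz : 0 < z) (hq : 0 ≤ q) (h : y ≤ q ^ 2 * z) :
    1 / √z ≤ q * (1 / √y) := by
  have hsy := Real.sqrt_pos.2 hy
  have hsz := Real.sqrt_pos.2 hz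
  have key : √y ≤ q * √z := by
    rw [Real.sqrt_le_left (by positivity), mul_pow, Real.sq_sqrt hz.le]
    exact h
  rw [mul_one_div, div_le_div_iff₀ hsz hsy]
  linarith

lemma le_one_div_sqrt {y z q : ℝ} (hy : 0 < y) (hz : 0 < z) (h : q ^ 2 * z ≤ y) :
    q * (1 / √y) ≤ 1 / √z := by
  have hsy := Real.sqrt_pos.2 hy
  have hsz := Real.sqrt_pos.2 hz
  have key : q * √z ≤ √y := by
    apply Real.le_sqrt_of_sq_le
    rw [mul_pow, Real.sq_sqrt hz.le]
    exact h
  rw [mul_one_div, div_le_div_iff₀ hsy hsz]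
  linarith

/-- A scaled second difference of `1/√y` is dominated by a first difference. -/
lemma second_difference_one_div_sqrt_lt {y : ℝ} (hy : 5 ≤ y) :
    (y - 5) * (1 / √(y - 1) + 1 / √(y + 1) - 2 * (1 / √y)) <
      2 * (1 / √(y + 1) - 1 / √(y + 2)) := by
  obtain ⟨t, ht, rfl⟩ : ∃ t : ℝ, 0 < t ∧ y = 1 / t :=
    ⟨1 / y, by positivity, by rw [one_div_one_div]⟩
  have ht5 : t ≤ 1 / 5 := by
    rw [le_div_iff₀ ht] at hy
    linarith
  have scale : ∀ k q : ℝ, q ^ 2 * (1 / t + k) = q ^ 2 * (1 + k * t) / t := by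
    intro k q
    field_simp
  have hr : 0 < 1 / √(1 / t) := by positivity
  have hA : 1 / √(1 / t - 1) ≤ (1 + t / 2 + 3 / 8 * t ^ 2 + 2 / 5 * t ^ 3) * (1 / √(1 / t)) := by
    apply one_div_sqrt_le (by positivity) (by linarith) (by positivity)
    rw [sub_eq_add_neg, scale, div_le_div_iff_of_pos_right ht]
    nlinarith [pow_pos ht 3, pow_pos ht 4, pow_pos ht 5, pow_pos ht 6,
      mul_nonneg (pow_pos ht 3).le (sub_nonneg.2 ht5), mul_nonneg (pow_pos ht 4).le (sub_nonneg.2 ht5),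
      mul_nonneg (pow_pos ht 5).le (sub_nonneg.2 ht5), mul_nonneg (pow_pos ht 6).le (sub_nonneg.2 ht5)]
  have hB : 1 / √(1 / t + 1) ≤ (1 - t / 2 + 3 / 8 * t ^ 2) * (1 / √(1 / t)) := by
    apply one_div_sqrt_le (by positivity) (by positivity) (by nlinarith)
    rw [scale, div_le_div_iff_of_pos_right ht]
    nlinarith [pow_pos ht 3, pow_pos ht 4, pow_pos ht 5,
      mul_nonneg (pow_pos ht 3).le (sub_nonneg.2 ht5), mul_nonneg (pow_pos ht 4).le (sub_nonneg.2 ht5)]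
  have hB' : (1 - t / 2 + 3 / 8 * t ^ 2 - 5 / 16 * t ^ 3) * (1 / √(1 / t)) ≤ 1 / √(1 / t + 1) := by
    apply le_one_div_sqrt (by positivity) (by positivity)
    rw [scale, div_le_div_iff_of_pos_right ht]
    nlinarith [pow_pos ht 3, pow_pos ht 4, pow_pos ht 5, pow_pos ht 6,
      mul_nonneg (pow_pos ht 3).le (sub_nonneg.2 ht5), mul_nonneg (pow_pos ht 4).le (sub_nonneg.2 ht5),
      mul_nonneg (pow_pos ht 5).le (sub_nonneg.2 ht5), mul_nonneg (pow_pos ht 6).le (sub_nonneg.2 ht5)]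
  have hC : 1 / √(1 / t + 2) ≤ (1 - t + 3 / 2 * t ^ 2) * (1 / √(1 / t)) := by
    apply one_div_sqrt_le (by positivity) (by positivity) (by nlinarith)
    rw [scale, div_le_div_iff_of_pos_right ht]
    nlinarith [pow_pos ht 3, pow_pos ht 4, pow_pos ht 5,
      mul_nonneg (pow_pos ht 3).le (sub_nonneg.2 ht5), mul_nonneg (pow_pos ht 4).le (sub_nonneg.2 ht5)]
  calc (1 / t - 5) * (1 / √(1 / t - 1) + 1 / √(1 / t + 1) - 2 * (1 / √(1 / t)))
      ≤ (1 / t - 5) * ((3 / 4 * t ^ 2 + 2 / 5 * t ^ 3) * (1 / √(1 / t))) :=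
        mul_le_mul_of_nonneg_left (by linarith) (by linarith)
    _ = (3 / 4 * t - 67 / 20 * t ^ 2 - 2 * t ^ 3) * (1 / √(1 / t)) := by
        rw [← mul_assoc]
        congr 1
        field_simp
        ring
    _ < (t - 9 / 4 * t ^ 2 - 5 / 8 * t ^ 3) * (1 / √(1 / t)) :=
        mul_lt_mul_of_pos_right (by nlinarith [pow_pos ht 2, pow_pos ht 3]) hr
    _ ≤ 2 * (1 / √(1 / t + 1) - 1 / √(1 / t + 2)) := by linarith

/-- The change of `χ(B_n(a,b))` under `(a, b) ↦ (a + 1, b - 1)` is `gap (a + 1) - gap b`. -/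
noncomputable def gap (x : ℝ) : ℝ := (x - 5) / √(x + 1) - (x - 4) / √x + 2 / √(x + 2)

lemma gap_add_one_lt {x : ℝ} (hx : 4 ≤ x) : gap (x + 1) < gap x := by
  have h := second_difference_one_div_sqrt_lt (y := x + 1) (by linarith)
  simp only [gap, add_sub_cancel_right, add_assoc] at h ⊢
  norm_num at h ⊢
  simp only [div_eq_mul_inv]
  linarith

lemma gap_add_one_lt_of_le {a b : ℤ} (hb : 4 ≤ b) (hab : b ≤ a) :
    gap ((a : ℝ) + 1) < gap b := by
  induction a, hab using Int.leInduction with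
  | base => exact gap_add_one_lt (by exact_mod_cast hb)
  | succ a hab ih =>
    push_cast
    refine (gap_add_one_lt ?_).trans ih
    have : (4 : ℝ) ≤ a := by exact_mod_cast hb.trans hab
    linarith

lemma gap_add_one_eq (x : ℝ) :
    gap (x + 1) = (x - 4) / √(x + 2) - (x - 3) / √(x + 1) + 2 / √(x + 3) := by
  rw [gap]
  ring_nf

lemma degR_eq_sum {V : Type*} [Fintype V] (G : SimpleGraph V) [DecidableRel G.Adj] (v : V) :
    degR G v = ∑ w, if G.Adj v w then 1 else 0 := by
  rw [degR, Set.ncard_eq_toFinset_card', ← Finset.card_filter]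
  congr 1
  ext w
  simp

namespace BabGraph

variable {a b : ℕ}

def core (i : Fin 4) : BabVert a b := Sum.inl i

def leafLeft (i : Fin (a - 3)) : BabVert a b := Sum.inr (Sum.inl i)

def leafRight (i : Fin (b - 3)) : BabVert a b := Sum.inr (Sum.inr i)

lemma sum_vert {M : Type*} [AddCommMonoid M] (f : BabVert a b → M) :
    ∑ v, f v = ∑ i, f (core i) + (∑ i, f (leafLeft i) + ∑ i, f (leafRight i)) := by
  refine (Fintype.sum_sum_type (α₁ := Fin 4) (α₂ := Fin (a - 3) ⊕ Fin (b - 3)) f).trans ?_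
  rw [Fintype.sum_sum_type]
  rfl

@[elab_as_elim]
lemma vert_cases {p : BabVert a b → Prop} (core : ∀ i, p (core i))
    (left : ∀ i, p (leafLeft i)) (right : ∀ i, p (leafRight i)) (v : BabVert a b) : p v := by
  rcases v with i | i | i
  exacts [core i, left i, right i]

@[simp] lemma core_inj {i j : Fin 4} : (core i : BabVert a b) = core j ↔ i = j :=
  Sum.inl_injective.eq_iff

@[simp] lemma leafLeft_inj {i j : Fin (a - 3)} :
    (leafLeft i : BabVert a b) = leafLeft j ↔ i = j :=
  (Sum.inr_injective.comp Sum.inl_injective).eq_iff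

@[simp] lemma leafRight_inj {i j : Fin (b - 3)} :
    (leafRight i : BabVert a b) = leafRight j ↔ i = j :=
  (Sum.inr_injective.comp Sum.inr_injective).eq_iff

@[simp] lemma core_ne_leafLeft (i : Fin 4) (j : Fin (a - 3)) :
    (core i : BabVert a b) ≠ leafLeft j := nofun

@[simp] lemma core_ne_leafRight (i : Fin 4) (j : Fin (b - 3)) :
    (core i : BabVert a b) ≠ leafRight j := nofun

@[simp] lemma leafLeft_ne_core (i : Fin 4) (j : Fin (a - 3)) :
    (leafLeft j : BabVert a b) ≠ core i := nofun

@[simp] lemma leafRight_ne_core (i : Fin 4) (j : Fin (b - 3)) :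
    (leafRight j : BabVert a b) ≠ core i := nofun

@[simp] lemma leafLeft_ne_leafRight (i : Fin (a - 3)) (j : Fin (b - 3)) :
    (leafLeft i : BabVert a b) ≠ leafRight j := nofun

@[simp] lemma leafRight_ne_leafLeft (i : Fin (a - 3)) (j : Fin (b - 3)) :
    (leafRight j : BabVert a b) ≠ leafLeft i := nofun

@[simp] lemma adj_core_core {i j : Fin 4} :
    (BabGraph a b).Adj (core i) (core j) ↔ i ≠ j ∧ (i.val < 2 ∨ j.val < 2) := by
  have : (BabGraph a b).Adj (core i) (core j) ↔ (core i : BabVert a b) ≠ core j ∧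
      (((i = 0 ∧ j = 1) ∨ (i = 0 ∧ j = 2) ∨ (i = 0 ∧ j = 3) ∨ (i = 1 ∧ j = 2) ∨ (i = 1 ∧ j = 3)) ∨
      ((j = 0 ∧ i = 1) ∨ (j = 0 ∧ i = 2) ∨ (j = 0 ∧ i = 3) ∨ (j = 1 ∧ i = 2) ∨
        (j = 1 ∧ i = 3))) := Iff.rfl
  rw [this, ne_eq, core_inj]
  clear this
  revert i j
  decide

@[simp] lemma adj_core_leafLeft {i : Fin 4} {j : Fin (a - 3)} :
    (BabGraph a b).Adj (core i) (leafLeft j) ↔ i = 0 :=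
  ⟨fun h => h.2.elim id False.elim, fun h => ⟨nofun, Or.inl h⟩⟩

@[simp] lemma adj_core_leafRight {i : Fin 4} {j : Fin (b - 3)} :
    (BabGraph a b).Adj (core i) (leafRight j) ↔ i = 1 :=
  ⟨fun h => h.2.elim id False.elim, fun h => ⟨nofun, Or.inl h⟩⟩

@[simp] lemma adj_leafLeft_core {i : Fin 4} {j : Fin (a - 3)} :
    (BabGraph a b).Adj (leafLeft j) (core i) ↔ i = 0 := by
  rw [adj_comm, adj_core_leafLeft]

@[simp] lemma adj_leafRight_core {i : Fin 4} {j : Fin (b - 3)} :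
    (BabGraph a b).Adj (leafRight j) (core i) ↔ i = 1 := by
  rw [adj_comm, adj_core_leafRight]

@[simp] lemma not_adj_leafLeft_leafLeft {i j : Fin (a - 3)} :
    ¬ (BabGraph a b).Adj (leafLeft i) (leafLeft j) :=
  fun h => h.2.elim id id

@[simp] lemma not_adj_leafRight_leafRight {i j : Fin (b - 3)} :
    ¬ (BabGraph a b).Adj (leafRight i) (leafRight j) :=
  fun h => h.2.elim id id

@[simp] lemma not_adj_leafLeft_leafRight {i : Fin (a - 3)} {j : Fin (b - 3)} :
    ¬ (BabGraph a b).Adj (leafLeft i) (leafRight j) :=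
  fun h => h.2.elim id id

@[simp] lemma not_adj_leafRight_leafLeft {i : Fin (a - 3)} {j : Fin (b - 3)} :
    ¬ (BabGraph a b).Adj (leafRight j) (leafLeft i) := by
  rw [adj_comm]
  exact not_adj_leafLeft_leafRight

lemma degR_core_zero (ha : 3 ≤ a) : degR (BabGraph a b) (core 0) = a := by
  classical
  rw [degR_eq_sum, sum_vert]
  simp [Fin.sum_univ_four]
  omega

lemma degR_core_one (hb : 3 ≤ b) : degR (BabGraph a b) (core 1) = b := by
  classical
  rw [degR_eq_sum, sum_vert]
  simp [Fin.sum_univ_four]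
  omega

lemma degR_core_two : degR (BabGraph a b) (core 2) = 2 := by
  classical
  rw [degR_eq_sum, sum_vert]
  simp
  decide

lemma degR_core_three : degR (BabGraph a b) (core 3) = 2 := by
  classical
  rw [degR_eq_sum, sum_vert]
  simp
  decide

lemma degR_leafLeft (i : Fin (a - 3)) : degR (BabGraph a b) (leafLeft i) = 1 := by
  classical
  rw [degR_eq_sum, sum_vert]
  simp

lemma degR_leafRight (i : Fin (b - 3)) : degR (BabGraph a b) (leafRight i) = 1 := by
  classical
  rw [degR_eq_sum, sum_vert]
  simp

/-- An enumeration of the edges of `BabGraph a b`. -/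
def edge : Fin 5 ⊕ Fin (a - 3) ⊕ Fin (b - 3) → Sym2 (BabVert a b)
  | .inl k => s(core (![0, 0, 0, 1, 1] k), core (![1, 2, 3, 2, 3] k))
  | .inr (.inl i) => s(core 0, leafLeft i)
  | .inr (.inr i) => s(core 1, leafRight i)

lemma edge_injective : Function.Injective (edge (a := a) (b := b)) := by
  rintro (k | i | i) (l | j | j) h <;> simp [edge] at h ⊢
  · revert k l
    decide
  · exact h
  · exact h

lemma range_edge : Set.range (edge (a := a) (b := b)) = (BabGraph a b).edgeSet := by
  ext e
  constructor
  · rintro ⟨k | i | i, rfl⟩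
    · simp only [edge, mem_edgeSet, adj_core_core]
      revert k
      decide
    · simp [edge]
    · simp [edge]
  · induction e with | _ u v
    rw [mem_edgeSet]
    induction u using vert_cases with
    | core i =>
      induction v using vert_cases with
      | core j =>
        have key : ∀ i j : Fin 4, i ≠ j ∧ (i.val < 2 ∨ j.val < 2) → ∃ k : Fin 5,
            (![0, 0, 0, 1, 1] k : Fin 4) = i ∧ (![1, 2, 3, 2, 3] k : Fin 4) = j ∨
            (![0, 0, 0, 1, 1] k : Fin 4) = j ∧ (![1, 2, 3, 2, 3] k : Fin 4) = i := by
          decide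
        intro h
        obtain ⟨k, hk⟩ := key i j (adj_core_core.1 h)
        exact ⟨.inl k, by simpa [edge] using hk⟩
      | left j =>
        rw [adj_core_leafLeft]
        rintro rfl
        exact ⟨.inr (.inl j), rfl⟩
      | right j =>
        rw [adj_core_leafRight]
        rintro rfl
        exact ⟨.inr (.inr j), rfl⟩
    | left i =>
      induction v using vert_cases with
      | core j =>
        rw [adj_leafLeft_core]
        rintro rfl
        exact ⟨.inr (.inl i), Sym2.eq_swap⟩
      | left j => simp
      | right j => simp
    | right i =>
      induction v using vert_cases with
      | core j =>
        rw [adj_leafRight_core]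
        rintro rfl
        exact ⟨.inr (.inr i), Sym2.eq_swap⟩
      | left j => simp
      | right j => simp

lemma sumConn_eq (ha : 3 ≤ a) (hb : 3 ≤ b) :
    sumConn (BabGraph a b) = 1 / √((a : ℝ) + b) + 2 / √((a : ℝ) + 2) + 2 / √((b : ℝ) + 2) +
      ((a : ℝ) - 3) / √((a : ℝ) + 1) + ((b : ℝ) - 3) / √((b : ℝ) + 1) := by
  have hE : (BabGraph a b).edgeSet.toFinite.toFinset =
      Finset.univ.map ⟨edge, edge_injective⟩ := by
    ext e
    simp [← range_edge]
  rw [sumConn, hE, Finset.sum_map, Fintype.sum_sum_type, Fintype.sum_sum_type]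
  simp only [Function.Embedding.coeFn_mk, edge, Sym2.lift_mk, Fin.sum_univ_five, degR_leafLeft,
    degR_leafRight, Matrix.cons_val, degR_core_zero ha, degR_core_one hb, degR_core_two,
    degR_core_three, Finset.sum_const, Finset.card_univ, Fintype.card_fin, nsmul_eq_mul,
    Nat.cast_sub ha, Nat.cast_sub hb]
  push_cast
  ring

end BabGraph

/-- For integers `a ≥ b ≥ 4`,
`(a−4)/√(a+2) − (a−3)/√(a+1) + 2/√(a+3) < (b−5)/√(b+1) − (b−4)/√b + 2/√(b+2)`.
Consequently, `χ(B_n(a,b)) > χ(B_n(a+1, b−1))` whenever `a ≥ b ≥ 4` and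
`a + b = n + 2`. -/
theorem stmt_9 :
    (∀ a b : ℤ, 4 ≤ b → b ≤ a →
      ((a : ℝ) - 4) / Real.sqrt ((a : ℝ) + 2) - ((a : ℝ) - 3) / Real.sqrt ((a : ℝ) + 1) +
          2 / Real.sqrt ((a : ℝ) + 3) <
        ((b : ℝ) - 5) / Real.sqrt ((b : ℝ) + 1) - ((b : ℝ) - 4) / Real.sqrt (b : ℝ) +
          2 / Real.sqrt ((b : ℝ) + 2)) ∧
    (∀ n a b : ℕ, 4 ≤ b → b ≤ a → a + b = n + 2 →
      sumConn (BabGraph a b) > sumConn (BabGraph (a + 1) (b - 1))) := by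
  refine ⟨fun a b hb hab => ?_, fun n a b hb hab _ => ?_⟩
  · rw [← gap_add_one_eq]
    exact gap_add_one_lt_of_le hb hab
  · have h := gap_add_one_lt_of_le (a := a) (b := b) (by exact_mod_cast hb) (by exact_mod_cast hab)
    rw [gap_add_one_eq, gap] at h
    rw [gt_iff_lt, BabGraph.sumConn_eq (by omega) (by omega),
      BabGraph.sumConn_eq (by omega) (by omega), Nat.cast_sub (by omega)]
    push_cast at h ⊢
    rw [show (a : ℝ) + 1 + (b - 1) = a + b by ring, show (a : ℝ) + 1 + 2 = a + 3 by ring,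
      show (b : ℝ) - 1 + 2 = b + 1 by ring, show (a : ℝ) + 1 + 1 = a + 2 by ring,
      show (b : ℝ) - 1 + 1 = b by ring]
    simp only [div_eq_mul_inv] at h ⊢
    linarith
end
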